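/- Let L_1, …, L_n be orthocomplemented simple closure spaces, L_i on Σ_i, and suppose that for each i, every irreducible component of L_i different from 2 is weakly connected; that is, for every atom p ∈ Σ_i whose central cover e(p) := ⋂{z ∈ L_i : z central and p ∈ z} contains at least two points, the interval [0, e(p)] = {b ∈ L_i : b ⊆ e(p)} (a simple closure space on e(p)) is weakly connected. Let L ∈ S(L_1,…,L_n) be a weak tensor product. If L admits an orthocomplementation, then L = ∧○_{i=1}^n L_i. -/

import Mathlib

open Set

namespace QLTensor

universe u v w

/-- A simple closure space on `X`: a set of subsets of `X`, closed under arbitrary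
set-intersections, containing `∅`, `univ` and all singletons. -/
def IsSCS {X : Type*} (L : Set (Set X)) : Prop :=
  (∀ ω ⊆ L, ⋂₀ ω ∈ L) ∧ ∅ ∈ L ∧ Set.univ ∈ L ∧ ∀ p : X, ({p} : Set X) ∈ L

/-- The join in a simple closure space: `⋁ A = ⋂ {b ∈ L | A ⊆ b}`. -/
def cl {X : Type*} (L : Set (Set X)) (A : Set X) : Set X :=
  ⋂₀ {b | b ∈ L ∧ A ⊆ b}

/-- `b` covers `a` in the lattice `L` (both belonging to `L`). -/
def CoversIn {X : Type*} (L : Set (Set X)) (a b : Set X) : Prop :=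
  a ∈ L ∧ b ∈ L ∧ a ⊂ b ∧ ∀ c ∈ L, a ⊂ c → c ⊂ b → False

/-- `x` is a coatom of `L` (covered by the top element `univ`). -/
def IsCoatomIn {X : Type*} (L : Set (Set X)) (x : Set X) : Prop :=
  x ∈ L ∧ x ≠ Set.univ ∧ ∀ c ∈ L, x ⊂ c → c = Set.univ

/-- `L` is coatomistic: every element is an intersection of coatoms. -/
def Coatomistic {X : Type*} (L : Set (Set X)) : Prop :=
  ∀ a ∈ L, a = ⋂₀ {x | IsCoatomIn L x ∧ a ⊆ x}

/-- The covering property: if `p ∧ a = 0` then `p ∨ a` covers `a`. -/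
def CovProp {X : Type*} (L : Set (Set X)) : Prop :=
  ∀ p : X, ∀ a ∈ L, p ∉ a → CoversIn L a (cl L (insert p a))

/-- The covering property of the dual lattice. -/
def DualCovProp {X : Type*} (L : Set (Set X)) : Prop :=
  ∀ x : Set X, IsCoatomIn L x → ∀ a ∈ L, cl L (a ∪ x) = Set.univ →
    CoversIn L (a ∩ x) a

/-- A DAC-lattice: `L` and its dual are atomistic with the covering property
(a simple closure space is automatically atomistic). -/
def IsDAC {X : Type*} (L : Set (Set X)) : Prop :=
  CovProp L ∧ Coatomistic L ∧ DualCovProp L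

/-- `(a, b)` is a modular pair: `(c ∨ a) ∧ b = c ∨ (a ∧ b)` for all `c ≤ b`. -/
def ModularPairIn {X : Type*} (L : Set (Set X)) (a b : Set X) : Prop :=
  ∀ c ∈ L, c ⊆ b → cl L (c ∪ a) ∩ b = cl L (c ∪ a ∩ b)

/-- `z` is a central element of the simple closure space `L`. -/
def IsCentralIn {X : Type*} (L : Set (Set X)) (z : Set X) : Prop :=
  zᶜ ∈ L ∧ ModularPairIn L z zᶜ ∧ ModularPairIn L zᶜ z

/-- `L` is irreducible: its only central elements are `∅` and `univ`. -/
def IrreducibleSCS {X : Type*} (L : Set (Set X)) : Prop :=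
  ∀ z ∈ L, IsCentralIn L z → z = ∅ ∨ z = Set.univ

/-- `N` is an orthocomplementation of the simple closure space `L`. -/
def IsOrtho {X : Type*} (L : Set (Set X)) (N : Set X → Set X) : Prop :=
  (∀ a ∈ L, N a ∈ L) ∧ (∀ a ∈ L, N (N a) = a) ∧
  (∀ a ∈ L, ∀ b ∈ L, a ⊆ b → N b ⊆ N a) ∧
  ∀ a ∈ L, cl L (a ∪ N a) = Set.univ

/-- `L` with orthocomplementation `N` is orthomodular. -/
def OrthomodularIn {X : Type*} (L : Set (Set X)) (N : Set X → Set X) : Prop :=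
  ∀ a ∈ L, ∀ b ∈ L, a ⊆ b → b = cl L (a ∪ b ∩ N a)

/-- `L` contains `MO₃`. -/
def ContainsMO3 {X : Type*} (L : Set (Set X)) : Prop :=
  ∃ p q r : X, p ≠ q ∧ p ≠ r ∧ q ≠ r ∧
    CoversIn L {p} (cl L {p, q}) ∧ CoversIn L {q} (cl L {p, q}) ∧
    CoversIn L {r} (cl L {p, q})

/-- `L` contains `MO₄`. -/
def ContainsMO4 {X : Type*} (L : Set (Set X)) : Prop :=
  ∃ p₁ p₂ p₃ p₄ : X,
    p₁ ≠ p₂ ∧ p₁ ≠ p₃ ∧ p₁ ≠ p₄ ∧ p₂ ≠ p₃ ∧ p₂ ≠ p₄ ∧ p₃ ≠ p₄ ∧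
    CoversIn L {p₁} (cl L {p₁, p₄}) ∧ CoversIn L {p₂} (cl L {p₁, p₄}) ∧
    CoversIn L {p₃} (cl L {p₁, p₄}) ∧ CoversIn L {p₄} (cl L {p₁, p₄})

/-- `L` is connected. -/
def ConnectedSCS {X : Type*} (L : Set (Set X)) : Prop :=
  (∃ p q : X, p ≠ q) ∧
  ∀ p q : X, p ≠ q → ∃ r : X, r ≠ p ∧ r ≠ q ∧ r ∈ cl L {p, q} ∧
    p ∈ cl L {q, r} ∧ q ∈ cl L {p, r}

/-- `L` is weakly connected: `L ≠ 2` and the point set admits a connected covering. -/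
def WeaklyConnected {X : Type*} (L : Set (Set X)) : Prop :=
  (∃ p q : X, p ≠ q) ∧
  ∃ 𝒜 : Set (Set X),
    ⋃₀ 𝒜 = Set.univ ∧
    (∀ A ∈ 𝒜, ∃ p ∈ A, ∃ q ∈ A, p ≠ q) ∧
    (∀ A ∈ 𝒜, ∀ p ∈ A, ∀ q ∈ A, p ≠ q → ∃ r, r ≠ p ∧ r ≠ q ∧ r ∈ cl L {p, q}) ∧
    ∀ p q : X, ∃ (m : ℕ) (c : Fin (m + 1) → Set X),
      (∀ i, c i ∈ 𝒜) ∧ p ∈ c 0 ∧ q ∈ c (Fin.last m) ∧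
      ∀ i : Fin m, ∃ x ∈ c i.castSucc ∩ c i.succ, ∃ y ∈ c i.castSucc ∩ c i.succ, x ≠ y

/-- The central cover `e(p)` of an atom `p`. -/
def centralCover {X : Type*} (L : Set (Set X)) (p : X) : Set X :=
  ⋂₀ {z | z ∈ L ∧ IsCentralIn L z ∧ p ∈ z}

/-- The interval `[0, e]` of `L`, viewed as a simple closure space on `e`. -/
def restrictSCS {X : Type*} (L : Set (Set X)) (e : Set X) : Set (Set ↥e) :=
  {B | Subtype.val '' B ∈ L}

/-- The automorphism group of `M` acts transitively on points. -/
def TransitiveSCS {X : Type*} (M : Set (Set X)) : Prop :=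
  ∀ p q : X, ∃ u : X ≃ X, (∀ a : Set X, a ∈ M ↔ u '' a ∈ M) ∧ u p = q

section Pi

variable {Ω : Type*} {σ : Ω → Type*}

/-- `⋃_α π_α⁻¹ (a α)`. -/
def unionCyl (a : ∀ α, Set (σ α)) : Set (∀ α, σ α) :=
  {p | ∃ α, p α ∈ a α}

/-- `∏_α a_α`. -/
def prodSet (a : ∀ α, Set (σ α)) : Set (∀ α, σ α) :=
  {p | ∀ α, p α ∈ a α}

/-- `p[A, β]`. -/
def cylSet (p : ∀ α, σ α) (β : Ω) (A : Set (σ β)) : Set (∀ α, σ α) :=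
  {q | q β ∈ A ∧ ∀ α, α ≠ β → q α = p α}

/-- `R_β[p]`. -/
def secSet (R : Set (∀ α, σ α)) (β : Ω) (p : ∀ α, σ α) : Set (σ β) :=
  {x | ∃ q ∈ R, q β = x ∧ ∀ α, α ≠ β → q α = p α}

/-- The separated product `∧○_α L_α`. -/
def wedgeO (L : ∀ α, Set (Set (σ α))) : Set (Set (∀ α, σ α)) :=
  {S | ∃ ω : Set (Set (∀ α, σ α)),
    (∀ y ∈ ω, ∃ a : ∀ α, Set (σ α), (∀ α, a α ∈ L α) ∧ y = unionCyl a) ∧ S = ⋂₀ ω}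

/-- The product `∨○_α L_α`. -/
def veeO (L : ∀ α, Set (Set (σ α))) : Set (Set (∀ α, σ α)) :=
  {R | ∀ (β : Ω) (p : ∀ α, σ α), secSet R β p ∈ L β}

/-- Axiom P2. -/
def AxiomP2 (L : ∀ α, Set (Set (σ α))) (M : Set (Set (∀ α, σ α))) : Prop :=
  ∀ a : ∀ α, Set (σ α), (∀ α, a α ∈ L α) → unionCyl a ∈ M

/-- Axiom P3. -/
def AxiomP3 (L : ∀ α, Set (Set (σ α))) (M : Set (Set (∀ α, σ α))) : Prop :=
  ∀ (p : ∀ α, σ α) (β : Ω) (A : Set (σ β)), cylSet p β A ∈ M → A ∈ L β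

/-- `M` is a weak tensor product of the family `L`, i.e. `M ∈ S(L_α, α ∈ Ω)`. -/
def IsWTP (L : ∀ α, Set (Set (σ α))) (M : Set (Set (∀ α, σ α))) : Prop :=
  IsSCS M ∧ AxiomP2 L M ∧ AxiomP3 L M

/-- `p # q` iff `p_β ⊥_β q_β` for some `β`. -/
def hashRel (N : ∀ α, Set (σ α) → Set (σ α)) (p q : ∀ α, σ α) : Prop :=
  ∃ β, p β ∈ N β {q β}

/-- `R^#`. -/
def sharp (N : ∀ α, Set (σ α) → Set (σ α)) (R : Set (∀ α, σ α)) :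
    Set (∀ α, σ α) :=
  {q | ∀ p ∈ R, hashRel N q p}

/-- A join-preserving map `u` is large. -/
def LargeMap (u : Set (∀ α, σ α) → Set (∀ α, σ α)) : Prop :=
  ∀ (β : Ω) (p : ∀ α, σ α),
    (¬ ∃ x, u (cylSet p β Set.univ) = {x}) ∧ ¬ u Set.univ ⊆ {q | q β = p β}

end Pi

section Binary

variable {X Y : Type*}

/-- The binary product `L₁ ∨○ L₂`. -/
def veeO2 (L1 : Set (Set X)) (L2 : Set (Set Y)) : Set (Set (X × Y)) :=
  {R | (∀ y : Y, {x | (x, y) ∈ R} ∈ L1) ∧ ∀ x : X, {y | (x, y) ∈ R} ∈ L2}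

/-- The binary separated product `L₁ ∧○ L₂`. -/
def wedgeO2 (L1 : Set (Set X)) (L2 : Set (Set Y)) : Set (Set (X × Y)) :=
  {S | ∃ ω : Set (Set (X × Y)),
    (∀ y ∈ ω, ∃ a₁ ∈ L1, ∃ a₂ ∈ L2,
      y = a₁ ×ˢ (Set.univ : Set Y) ∪ (Set.univ : Set X) ×ˢ a₂) ∧
    S = ⋂₀ ω}

end Binary

section Ortho

variable {X : Type*} {L : Set (Set X)} {N : Set X → Set X}

theorem IsSCS.inter_mem (hL : IsSCS L) {a b : Set X} (ha : a ∈ L) (hb : b ∈ L) : a ∩ b ∈ L := by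
  rw [← sInter_pair]
  exact hL.1 _ (by rintro x (rfl | rfl) <;> assumption)

theorem subset_cl (L : Set (Set X)) (A : Set X) : A ⊆ cl L A :=
  fun _ hx _ hb => hb.2 hx

theorem cl_subset {A b : Set X} (hb : b ∈ L) (h : A ⊆ b) : cl L A ⊆ b :=
  sInter_subset_of_mem ⟨hb, h⟩

theorem cl_eq_self {a : Set X} (ha : a ∈ L) : cl L a = a :=
  (cl_subset ha subset_rfl).antisymm (subset_cl L a)

theorem IsOrtho.subset_iff (h : IsOrtho L N) {a b : Set X} (ha : a ∈ L) (hb : b ∈ L) :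
    N b ⊆ N a ↔ a ⊆ b := by
  refine ⟨fun hab => ?_, h.2.2.1 a ha b hb⟩
  have := h.2.2.1 _ (h.1 b hb) _ (h.1 a ha) hab
  rwa [h.2.1 a ha, h.2.1 b hb] at this

theorem IsOrtho.mem_iff (hL : IsSCS L) (h : IsOrtho L N) {a : Set X} (ha : a ∈ L) {x : X} :
    N a ⊆ N {x} ↔ x ∈ a := by
  rw [h.subset_iff (hL.2.2.2 x) ha, singleton_subset_iff]

theorem IsOrtho.subset_singleton (hL : IsSCS L) (h : IsOrtho L N) {a : Set X} (ha : a ∈ L)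
    {y : X} (hy : y ∈ N a) : a ⊆ N {y} := by
  have := (h.mem_iff hL (h.1 a ha)).2 hy
  rwa [h.2.1 a ha] at this

theorem IsOrtho.mem_symm (hL : IsSCS L) (h : IsOrtho L N) {x y : X} (hxy : x ∈ N {y}) :
    y ∈ N {x} :=
  h.subset_singleton hL (hL.2.2.2 y) hxy rfl

theorem IsOrtho.mem_comm (hL : IsSCS L) (h : IsOrtho L N) {x y : X} :
    x ∈ N {y} ↔ y ∈ N {x} :=
  ⟨h.mem_symm hL, h.mem_symm hL⟩

theorem IsOrtho.empty (hL : IsSCS L) (h : IsOrtho L N) : N ∅ = univ := by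
  refine univ_subset_iff.1 ?_
  have := h.2.2.1 ∅ hL.2.1 _ (h.1 _ hL.2.2.1) (empty_subset _)
  rwa [h.2.1 _ hL.2.2.1] at this

theorem IsOrtho.inter_eq_empty (hL : IsSCS L) (h : IsOrtho L N) {a : Set X} (ha : a ∈ L) :
    a ∩ N a = ∅ := by
  have hm := hL.inter_mem ha (h.1 a ha)
  have hu : N (a ∩ N a) = univ := by
    rw [← univ_subset_iff, ← h.2.2.2 a ha]
    refine cl_subset (h.1 _ hm) (union_subset ?_ ?_)
    · have := h.2.2.1 _ hm _ (h.1 a ha) inter_subset_right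
      rwa [h.2.1 a ha] at this
    · exact h.2.2.1 _ hm _ ha inter_subset_left
  rw [← h.2.1 _ hm, hu, ← h.empty hL, h.2.1 _ hL.2.1]

theorem IsOrtho.notMem_self (hL : IsSCS L) (h : IsOrtho L N) (x : X) : x ∉ N {x} := fun hx => by
  have : x ∈ ({x} ∩ N {x} : Set X) := ⟨rfl, hx⟩
  rwa [h.inter_eq_empty hL (hL.2.2.2 x)] at this

theorem IsOrtho.eq_univ_of_mem (hL : IsSCS L) (h : IsOrtho L N) {a : Set X} (ha : a ∈ L)
    {x y : X} (hx : N {x} ⊆ a) (hy : y ∈ a) (hyx : y ∉ N {x}) : a = univ := by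
  rw [← h.2.1 a ha, ← h.empty hL]
  congr 1
  have hsub : N a ⊆ {x} := by
    rwa [← h.subset_iff (h.1 a ha) (hL.2.2.2 x), h.2.1 a ha]
  rcases subset_singleton_iff_eq.1 hsub with h0 | h0
  · exact h0
  · rw [← h.2.1 a ha, h0] at hy
    exact absurd hy hyx

theorem IsCentralIn.compl {z : Set X} (hz : z ∈ L) (h : IsCentralIn L z) :
    IsCentralIn L zᶜ :=
  ⟨by rwa [compl_compl], by simpa using h.2.2, by simpa using h.2.1⟩

theorem IsOrtho.central_eq_compl (hL : IsSCS L) (h : IsOrtho L N) {z : Set X} (hz : z ∈ L)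
    (hc : IsCentralIn L z) : N z = zᶜ := by
  have hsub : N z ⊆ zᶜ := fun x hx hxz => by
    have : x ∈ z ∩ N z := ⟨hxz, hx⟩
    rwa [h.inter_eq_empty hL hz] at this
  have hm := hc.2.1 (N z) (h.1 z hz) hsub
  rw [union_comm, h.2.2.2 z hz, inter_compl_self, union_empty, univ_inter,
    cl_eq_self (h.1 z hz)] at hm
  exact hm.symm

theorem centralCover_mem (hL : IsSCS L) (p : X) : centralCover L p ∈ L :=
  hL.1 _ fun _ hz => hz.1

theorem mem_centralCover_self (p : X) : p ∈ centralCover L p :=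
  fun _ hz => hz.2.2

theorem mem_centralCover_iff {p q : X} :
    q ∈ centralCover L p ↔ ∀ z ∈ L, IsCentralIn L z → (p ∈ z ↔ q ∈ z) := by
  refine ⟨fun h z hz hc => ⟨fun hp => h z ⟨hz, hc, hp⟩, fun hq => ?_⟩,
    fun h z hz => (h z hz.1 hz.2.1).1 hz.2.2⟩
  by_contra hp
  exact h zᶜ ⟨hc.1, hc.compl hz, hp⟩ hq

theorem equivalence_centralCover (L : Set (Set X)) :
    Equivalence fun p q => q ∈ centralCover L p := by
  simp only [mem_centralCover_iff]
  exact ⟨fun _ _ _ _ => Iff.rfl, fun h z hz hc => (h z hz hc).symm,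
    fun h h' z hz hc => (h z hz hc).trans (h' z hz hc)⟩

theorem IsOrtho.mem_of_notMem_centralCover (hL : IsSCS L) (h : IsOrtho L N) {p q : X}
    (hpq : q ∉ centralCover L p) : p ∈ N {q} := by
  simp only [centralCover, mem_sInter, not_forall] at hpq
  obtain ⟨z, ⟨hz, hc, hp⟩, hq⟩ := hpq
  refine h.mem_symm hL (h.2.2.1 _ (hL.2.2.2 p) _ hz (singleton_subset_iff.2 hp) ?_)
  rwa [h.central_eq_compl hL hz hc]

theorem cl_restrictSCS_subset (hL : IsSCS L) {e : Set X} (he : e ∈ L) {x y r : e}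
    (hr : r ∈ cl (restrictSCS L e) {x, y}) : (r : X) ∈ cl L {(x : X), (y : X)} := by
  rintro b ⟨hb, hxy⟩
  refine hr (Subtype.val ⁻¹' b) ⟨?_, ?_⟩
  · change Subtype.val '' (Subtype.val ⁻¹' b) ∈ L
    rw [Subtype.image_preimage_coe]
    exact hL.inter_mem he hb
  · rintro z (rfl | rfl)
    · exact hxy (Or.inl rfl)
    · exact hxy (Or.inr rfl)

theorem WeaklyConnected.exists_third (h : WeaklyConnected L) (x y : X) :
    ∃ r, r ≠ x ∧ r ≠ y := by
  obtain ⟨_, 𝒜, hU, h2, h3, _⟩ := h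
  obtain ⟨A, hA, -⟩ : x ∈ ⋃₀ 𝒜 := hU ▸ mem_univ x
  obtain ⟨p, hp, q, hq, hpq⟩ := h2 A hA
  obtain ⟨r, hrp, hrq, -⟩ := h3 A hA p hp q hq hpq
  by_contra! hcon
  have h1 := hcon p
  have h2 := hcon q
  have h3 := hcon r
  clear hcon
  by_cases hpx : p = x
  · exact hrq ((h3 (hpx ▸ hrp)).trans (h2 (hpx ▸ hpq.symm)).symm)
  by_cases hqx : q = x
  · exact hrp ((h3 (hqx ▸ hrq)).trans (h1 hpx).symm)
  · exact hpq ((h1 hpx).trans (h2 hqx).symm)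

end Ortho

section AgreeOff

variable {Ω : Type*} {σ : Ω → Type*}

/-- `p` and `q` agree in every coordinate except possibly `k`. -/
def AgreeOff (k : Ω) (p q : ∀ α, σ α) : Prop :=
  ∀ j, j ≠ k → p j = q j

theorem AgreeOff.symm {k : Ω} {p q : ∀ α, σ α} (h : AgreeOff k p q) : AgreeOff k q p :=
  fun j hj => (h j hj).symm

theorem AgreeOff.trans {k : Ω} {p q r : ∀ α, σ α} (h : AgreeOff k p q) (h' : AgreeOff k q r) :
    AgreeOff k p r :=
  fun j hj => (h j hj).trans (h' j hj)

theorem AgreeOff.ne {k : Ω} {p q : ∀ α, σ α} (h : AgreeOff k p q) (hpq : p ≠ q) : p k ≠ q k :=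
  fun hk => hpq <| funext fun j => by
    by_cases hj : j = k
    · exact hj ▸ hk
    · exact h j hj

/-- If two distinct points agree off `k`, any third point lying on a line with each of them
lies on their line. -/
theorem AgreeOff.third {k l m : Ω} {a b c : ∀ α, σ α} (hab : AgreeOff k a b) (hne : a ≠ b)
    (hac : AgreeOff l a c) (hbc : AgreeOff m b c) : AgreeOff k a c := by
  by_cases hca : a = c
  · exact hca ▸ fun _ _ => rfl
  by_cases hlk : l = k
  · exact hlk ▸ hac
  have h1 := hac.ne hca
  have hml : l = m := by
    by_contra hlm
    exact h1 ((hab l hlk).trans (hbc l hlm))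
  subst hml
  exact absurd ((hac.trans hbc.symm) k (Ne.symm hlk)) (hab.ne hne)

/-- An injective family along a weakly connected space, any two members of which agree off some
coordinate whenever their join contains a third atom, has any two members agreeing off some
coordinate. -/
theorem WeaklyConnected.exists_agreeOff {X : Type*} {L : Set (Set X)} (h : WeaklyConnected L)
    {F : X → ∀ α, σ α} (hF : Function.Injective F)
    (hadj : ∀ x y r, r ≠ x → r ≠ y → r ∈ cl L {x, y} → ∃ k, AgreeOff k (F x) (F y))
    (x y : X) : ∃ k, AgreeOff k (F x) (F y) := by
  obtain ⟨_, 𝒜, -, h2, h3, h4⟩ := h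
  have hA : ∀ A ∈ 𝒜, ∀ p ∈ A, ∀ q ∈ A, p ≠ q → ∃ k, AgreeOff k (F p) (F q) := by
    intro A hA p hp q hq hpq
    obtain ⟨r, hrp, hrq, hr⟩ := h3 A hA p hp q hq hpq
    exact hadj p q r hrp hrq hr
  have hline : ∀ A ∈ 𝒜, ∀ p ∈ A, ∀ q ∈ A, p ≠ q → ∀ k, AgreeOff k (F p) (F q) →
      ∀ z ∈ A, AgreeOff k (F p) (F z) := by
    intro A hAm p hp q hq hpq k hk z hz
    by_cases hpz : p = z
    · exact hpz ▸ fun _ _ => rfl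
    by_cases hqz : q = z
    · exact hqz ▸ hk
    obtain ⟨l, hl⟩ := hA A hAm p hp z hz hpz
    obtain ⟨m, hm⟩ := hA A hAm q hq z hz hqz
    exact hk.third (hF.ne hpq) hl hm
  obtain ⟨m, c, hc, hx, hy, hcap⟩ := h4 x y
  obtain ⟨p, hp, q, hq, hpq⟩ := h2 (c 0) (hc 0)
  obtain ⟨k, hk⟩ := hA _ (hc 0) p hp q hq hpq
  have hpx := hline _ (hc 0) p hp q hq hpq k hk x hx
  refine ⟨k, ?_⟩
  suffices hall : ∀ i, ∀ z ∈ c i, AgreeOff k (F x) (F z) from hall _ y hy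
  intro i
  induction i using Fin.induction with
  | zero => exact fun z hz => hpx.symm.trans (hline _ (hc 0) p hp q hq hpq k hk z hz)
  | succ i ih =>
    intro z hz
    obtain ⟨a, ha, b, hb, hab⟩ := hcap i
    have hka := ih a ha.1
    have hkb := ih b hb.1
    exact hka.trans (hline _ (hc _) a ha.2 b hb.2 hab k (hka.symm.trans hkb) z hz)

/-- Pass from `p` to `q` by changing one coordinate at a time. -/
theorem coordinate_induction [Finite Ω] [DecidableEq Ω] {P : (∀ α, σ α) → Prop}
    {p q : ∀ α, σ α} (hp : P p)
    (step : ∀ w i, (∀ j, w j = p j ∨ w j = q j) → P w → P (Function.update w i (q i))) :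
    P q := by
  have := Fintype.ofFinite Ω
  have key : ∀ S : Finset Ω, P (S.piecewise q p) := by
    intro S
    induction S using Finset.induction_on with
    | empty => simpa using hp
    | insert i S _ ih =>
      rw [Finset.piecewise_insert]
      refine step _ i (fun j => ?_) ih
      by_cases hj : j ∈ S <;> simp [hj]
  simpa using key Finset.univ

end AgreeOff

section WeakTensorProduct

variable {Ω : Type*} {σ : Ω → Type*} {L : ∀ α, Set (Set (σ α))}
  {N : ∀ α, Set (σ α) → Set (σ α)} {M : Set (Set (∀ α, σ α))}

/-- The set of points `#`-orthogonal to the point `q`. -/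
def pointSharp (N : ∀ α, Set (σ α) → Set (σ α)) (q : ∀ α, σ α) : Set (∀ α, σ α) :=
  unionCyl fun α => N α {q α}

theorem mem_pointSharp {p q : ∀ α, σ α} : p ∈ pointSharp N q ↔ ∃ α, p α ∈ N α {q α} :=
  Iff.rfl

theorem pointSharp_comm (hL : ∀ α, IsSCS (L α)) (hN : ∀ α, IsOrtho (L α) (N α))
    {p q : ∀ α, σ α} : p ∈ pointSharp N q ↔ q ∈ pointSharp N p :=
  exists_congr fun α => (hN α).mem_comm (hL α)

theorem notMem_pointSharp_self (hL : ∀ α, IsSCS (L α)) (hN : ∀ α, IsOrtho (L α) (N α))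
    (q : ∀ α, σ α) : q ∉ pointSharp N q :=
  fun ⟨α, h⟩ => (hN α).notMem_self (hL α) _ h

theorem pointSharp_mem (hL : ∀ α, IsSCS (L α)) (hN : ∀ α, IsOrtho (L α) (N α))
    (hM : IsWTP L M) (q : ∀ α, σ α) : pointSharp N q ∈ M :=
  hM.2.1 _ fun α => (hN α).1 _ ((hL α).2.2.2 _)

theorem pointSharp_injective (hL : ∀ α, IsSCS (L α)) (hN : ∀ α, IsOrtho (L α) (N α)) :
    Function.Injective (pointSharp N) := by
  classical
  intro p q hpq
  funext i
  have hsub : N i {p i} ⊆ N i {q i} := by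
    intro x hx
    have hw : Function.update q i x ∈ pointSharp N q := by
      rw [← hpq]
      exact ⟨i, by simpa using hx⟩
    obtain ⟨j, hj⟩ := hw
    by_cases hji : j = i
    · subst hji
      simpa using hj
    · rw [Function.update_of_ne hji] at hj
      exact absurd hj ((hN j).notMem_self (hL j) _)
  exact (((hN i).mem_iff (hL i) ((hL i).2.2.2 _)).1 hsub).symm

variable {N' : Set (∀ α, σ α) → Set (∀ α, σ α)} {φ : (∀ α, σ α) → ∀ α, σ α}

theorem ortho_map_adjoint (hM : IsWTP L M) (hN' : IsOrtho M N')
    (hφ : ∀ q, N' {φ q} = pointSharp N q)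
    (p q : ∀ α, σ α) : φ p ∈ N' {q} ↔ q ∈ pointSharp N p := by
  rw [hN'.mem_comm hM.1, hφ]

theorem ortho_map_injective (hL : ∀ α, IsSCS (L α)) (hN : ∀ α, IsOrtho (L α) (N α))
    (hφ : ∀ q, N' {φ q} = pointSharp N q) : Function.Injective φ := fun p q h =>
  pointSharp_injective hL hN (by rw [← hφ, ← hφ, h])

theorem ortho_map_notMem (hM : IsWTP L M) (hN' : IsOrtho M N')
    (hφ : ∀ q, N' {φ q} = pointSharp N q)
    (q : ∀ α, σ α) : φ q ∉ pointSharp N q :=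
  hφ q ▸ hN'.notMem_self hM.1 (φ q)

theorem ortho_map_mem_cl (hL : ∀ α, IsSCS (L α)) (hN : ∀ α, IsOrtho (L α) (N α))
    (hM : IsWTP L M) (hN' : IsOrtho M N') (hφ : ∀ q, N' {φ q} = pointSharp N q)
    {p q r : ∀ α, σ α} (hr : r ∈ cl M {p, q}) : φ r ∈ cl M {φ p, φ q} := by
  rintro b ⟨hb, hpq⟩
  have hb' : ∀ x, φ x ∈ b ↔ ∀ t ∈ N' b, x ∈ pointSharp N t := fun x => by
    rw [← hN'.mem_iff hM.1 hb, hφ]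
    exact forall₂_congr fun t _ => pointSharp_comm hL hN
  rw [hb']
  intro t ht
  refine hr _ ⟨pointSharp_mem hL hN hM t, ?_⟩
  rintro x (rfl | rfl)
  · exact (hb' _).1 (hpq (Or.inl rfl)) t ht
  · exact (hb' _).1 (hpq (Or.inr rfl)) t ht

variable [DecidableEq Ω]

theorem section_mem (hL : ∀ α, IsSCS (L α)) (hM : IsWTP L M) {a : Set (∀ α, σ α)} (ha : a ∈ M)
    (w : ∀ α, σ α) (i : Ω) : {x | Function.update w i x ∈ a} ∈ L i := by
  refine hM.2.2 w i _ ?_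
  have hcyl : cylSet w i univ ∈ M := by
    have : cylSet w i univ = ⋂₀ ((fun j => unionCyl (Function.update
        (fun α => (∅ : Set (σ α))) j {w j})) '' {j | j ≠ i}) := by
      ext q
      simp only [cylSet, unionCyl, mem_univ, true_and, sInter_image, mem_iInter, mem_ofPred_eq]
      refine forall₂_congr fun j _ => ⟨fun h => ⟨j, by simp [h]⟩, ?_⟩
      rintro ⟨α, hα⟩
      by_cases hαj : α = j
      · subst hαj
        simpa using hα
      · simp [Function.update_of_ne hαj] at hα
    rw [this]
    refine hM.1.1 _ ?_
    rintro _ ⟨j, -, rfl⟩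
    refine hM.2.1 _ fun α => ?_
    by_cases hαj : α = j
    · subst hαj
      simpa using (hL α).2.2.2 _
    · simpa [Function.update_of_ne hαj] using (hL α).2.1
  have heq : cylSet w i {x | Function.update w i x ∈ a} = a ∩ cylSet w i univ := by
    ext q
    have hq : (∀ α, α ≠ i → q α = w α) → Function.update w i (q i) = q := fun h => by
      funext α
      by_cases hα : α = i
      · subst hα
        simp
      · simp [hα, h α hα]
    constructor
    · rintro ⟨h1, h2⟩
      exact ⟨hq h2 ▸ h1, mem_univ _, h2⟩
    · rintro ⟨h1, -, h2⟩
      refine ⟨?_, h2⟩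
      rw [mem_ofPred_eq, hq h2]
      exact h1
  rw [heq]
  exact hM.1.inter_mem ha hcyl

theorem update_mem_cl (hL : ∀ α, IsSCS (L α)) (hM : IsWTP L M) (w : ∀ α, σ α) (i : Ω)
    {x y r : σ i} (hr : r ∈ cl (L i) {x, y}) :
    Function.update w i r ∈ cl M {Function.update w i x, Function.update w i y} := by
  rintro b ⟨hb, hxy⟩
  refine hr _ ⟨section_mem hL hM hb w i, ?_⟩
  rintro z (rfl | rfl)
  · exact hxy (Or.inl rfl)
  · exact hxy (Or.inr rfl)

theorem exists_agreeOff_of_mem_cl (hL : ∀ α, IsSCS (L α)) (hM : IsWTP L M)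
    {p q r : ∀ α, σ α} (hr : r ∈ cl M {p, q}) (hrp : r ≠ p) (hrq : r ≠ q) :
    ∃ k, AgreeOff k p q := by
  have key : ∀ i j, i ≠ j → r i = p i ∨ r j = q j := by
    intro i j hij
    have hmem : unionCyl (Function.update (Function.update
        (fun α => (∅ : Set (σ α))) i {p i}) j {q j}) ∈ M := by
      refine hM.2.1 _ fun α => ?_
      by_cases hαj : α = j
      · subst hαj
        simpa using (hL α).2.2.2 _
      rw [Function.update_of_ne hαj]
      by_cases hαi : α = i
      · subst hαi
        simpa using (hL α).2.2.2 _
      · simpa [Function.update_of_ne hαi] using (hL α).2.1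
    obtain ⟨α, hα⟩ := hr _ ⟨hmem, by
      rintro z (rfl | rfl)
      · exact ⟨i, by simp [hij]⟩
      · exact ⟨j, by simp⟩⟩
    by_cases hαj : α = j
    · subst hαj
      exact Or.inr (by simpa using hα)
    rw [Function.update_of_ne hαj] at hα
    by_cases hαi : α = i
    · subst hαi
      exact Or.inl (by simpa using hα)
    · simp [Function.update_of_ne hαi] at hα
  obtain ⟨i, hi⟩ := Function.ne_iff.1 hrp
  have hq : ∀ j, j ≠ i → r j = q j := fun j hj => (key i j hj.symm).resolve_left hi
  have hqi : r i ≠ q i := AgreeOff.ne hq hrq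
  exact ⟨i, fun j hj => ((key j i hj).resolve_right hqi).symm.trans (hq j hj)⟩

theorem eq_univ_of_pointSharp_subset [Finite Ω] (hL : ∀ α, IsSCS (L α))
    (hN : ∀ α, IsOrtho (L α) (N α)) (hM : IsWTP L M) {a : Set (∀ α, σ α)} (ha : a ∈ M)
    {q r : ∀ α, σ α} (hq : pointSharp N q ⊆ a) (hr : r ∈ a) (hrq : r ∉ pointSharp N q) :
    a = univ := by
  refine eq_univ_of_forall fun t => ?_
  by_cases ht : t ∈ pointSharp N q
  · exact hq ht
  refine coordinate_induction (P := fun w => w ∈ a) hr fun w i hw hwa => ?_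
  have hwq : w i ∉ N i {q i} := fun h => by
    rcases hw i with h' | h'
    · exact hrq ⟨i, h' ▸ h⟩
    · exact ht ⟨i, h' ▸ h⟩
  have huniv := (hN i).eq_univ_of_mem (hL i) (section_mem hL hM ha w i) (x := q i) (y := w i)
    (fun x hx => hq ⟨i, by simpa using hx⟩) (by simpa using hwa) hwq
  change t i ∈ {x | Function.update w i x ∈ a}
  rw [huniv]
  exact mem_univ _

/-- Every `pointSharp` is the `N'`-orthocomplement of a point of `M`. -/
theorem exists_ortho_eq_pointSharp [Finite Ω] (hL : ∀ α, IsSCS (L α))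
    (hN : ∀ α, IsOrtho (L α) (N α)) (hM : IsWTP L M) {N' : Set (∀ α, σ α) → Set (∀ α, σ α)}
    (hN' : IsOrtho M N') (q : ∀ α, σ α) : ∃ r, N' {r} = pointSharp N q := by
  have hm := pointSharp_mem hL hN hM q
  obtain ⟨r, hr⟩ : (N' (pointSharp N q)).Nonempty := by
    rw [nonempty_iff_ne_empty]
    intro h0
    refine notMem_pointSharp_self hL hN q ?_
    rw [← hN'.2.1 _ hm, h0, hN'.empty hM.1]
    trivial
  have hsub := hN'.subset_singleton hM.1 hm hr
  refine ⟨r, Subset.antisymm (fun x hx => ?_) hsub⟩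
  by_contra hxq
  have := eq_univ_of_pointSharp_subset hL hN hM (hN'.1 _ (hM.1.2.2.2 r)) hsub hx hxq
  exact hN'.notMem_self hM.1 r (this ▸ mem_univ r)

/-- `φ` maps the part of the `β`-line through `s` in the central component of `s β`
into the `k`-line through `φ s`. -/
def MapsLine (L : ∀ α, Set (Set (σ α))) (φ : (∀ α, σ α) → ∀ α, σ α) (β k : Ω)
    (s : ∀ α, σ α) : Prop :=
  ∀ x ∈ centralCover (L β) (s β), AgreeOff k (φ (Function.update s β x)) (φ s)

theorem exists_mapsLine (hL : ∀ α, IsSCS (L α)) (hN : ∀ α, IsOrtho (L α) (N α))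
    (hM : IsWTP L M) (hN' : IsOrtho M N') (hφ : ∀ q, N' {φ q} = pointSharp N q)
    (hcomp : ∀ α, ∀ p : σ α,
      (∃ q ∈ centralCover (L α) p, ∃ r ∈ centralCover (L α) p, q ≠ r) →
      WeaklyConnected (restrictSCS (L α) (centralCover (L α) p)))
    (β : Ω) (s : ∀ α, σ α) : ∃ k, MapsLine L φ β k s := by
  have hs := mem_centralCover_self (L := L β) (s β)
  by_cases htriv : ∀ x ∈ centralCover (L β) (s β), x = s β
  · refine ⟨β, fun x hx => ?_⟩
    rw [htriv x hx, Function.update_eq_self]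
    exact fun _ _ => rfl
  push Not at htriv
  obtain ⟨y, hy, hys⟩ := htriv
  have hwc := hcomp β (s β) ⟨y, hy, s β, hs, hys⟩
  have hF : Function.Injective
      fun x : centralCover (L β) (s β) => φ (Function.update s β (x : σ β)) := fun x x' h =>
    Subtype.ext (Function.update_injective s β (ortho_map_injective hL hN hφ h))
  have hpair := hwc.exists_agreeOff hF fun x x' r hrx hrx' hr =>
    exists_agreeOff_of_mem_cl hL hM
      (ortho_map_mem_cl hL hN hM hN' hφ (update_mem_cl hL hM s β
        (cl_restrictSCS_subset (hL β) (centralCover_mem (hL β) _) hr)))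
      (hF.ne hrx) (hF.ne hrx')
  obtain ⟨k, hk⟩ := hpair ⟨s β, hs⟩ ⟨y, hy⟩
  refine ⟨k, fun x hx => ?_⟩
  obtain ⟨l, hl⟩ := hpair ⟨s β, hs⟩ ⟨x, hx⟩
  obtain ⟨m, hm⟩ := hpair ⟨y, hy⟩ ⟨x, hx⟩
  have hne : (⟨s β, hs⟩ : centralCover (L β) (s β)) ≠ ⟨y, hy⟩ := fun h =>
    hys (congrArg Subtype.val h).symm
  simpa using (hk.third (hF.ne hne) hl hm).symm

theorem MapsLine.update (hL : ∀ α, IsSCS (L α)) (hN : ∀ α, IsOrtho (L α) (N α))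
    (hφ : ∀ q, N' {φ q} = pointSharp N q)
    (hcomp : ∀ α, ∀ p : σ α,
      (∃ q ∈ centralCover (L α) p, ∃ r ∈ centralCover (L α) p, q ≠ r) →
      WeaklyConnected (restrictSCS (L α) (centralCover (L α) p)))
    (hex : ∀ β s, ∃ k, MapsLine L φ β k s) {β k : Ω} {s : ∀ α, σ α}
    (h : MapsLine L φ β k s) (γ : Ω) {z : σ γ} (hz : z ∈ centralCover (L γ) (s γ)) :
    MapsLine L φ β k (Function.update s γ z) := by
  have hequiv := equivalence_centralCover (L γ)
  by_cases hγ : γ = β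
  · subst hγ
    intro x hx
    rw [Function.update_self] at hx
    rw [Function.update_idem]
    exact (h x (hequiv.trans hz hx)).trans (h z hz).symm
  set q := Function.update s γ z with hq
  have hqβ : q β = s β := Function.update_of_ne (Ne.symm hγ) _ _
  by_cases htriv : ∀ x ∈ centralCover (L β) (s β), x = s β
  · intro x hx
    rw [hqβ] at hx
    rw [htriv x hx, ← hqβ, Function.update_eq_self]
    exact fun _ _ => rfl
  push Not at htriv
  obtain ⟨y, hy, hys⟩ := htriv
  have hs := mem_centralCover_self (L := L β) (s β)
  obtain ⟨⟨w, hw⟩, hws, hwy⟩ := (hcomp β (s β) ⟨y, hy, s β, hs, hys⟩).exists_third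
    ⟨s β, hs⟩ ⟨y, hy⟩
  simp only [ne_eq, Subtype.mk.injEq] at hws hwy
  obtain ⟨k', hk'⟩ := hex β q
  by_cases hkk : k = k'
  · exact hkk ▸ hk'
  exfalso
  have hinj := ortho_map_injective hL hN hφ
  have hcross : ∀ x, ∃ m, AgreeOff m (φ (Function.update s β x)) (φ (Function.update q β x)) := by
    intro x
    obtain ⟨m, hm⟩ := hex γ (Function.update s β x)
    refine ⟨m, ?_⟩
    rw [hq, Function.update_comm hγ]
    exact (hm z (by rwa [Function.update_of_ne hγ])).symm
  choose m hm using hcross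
  have hpair : ∀ x ∈ centralCover (L β) (s β), ∀ x' ∈ centralCover (L β) (s β), x ≠ x' →
      (m x = k ∨ m x' = k) ∧ (m x = k' ∨ m x' = k') := by
    intro x hx x' hx' hxx
    have hP : AgreeOff k (φ (Function.update s β x)) (φ (Function.update s β x')) :=
      (h x hx).trans (h x' hx').symm
    have hQ : AgreeOff k' (φ (Function.update q β x)) (φ (Function.update q β x')) :=
      (hk' x (by rwa [hqβ])).trans (hk' x' (by rwa [hqβ])).symm
    have hPne := hP.ne (hinj.ne ((Function.update_injective s β).ne hxx))
    have hQne := hQ.ne (hinj.ne ((Function.update_injective q β).ne hxx))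
    constructor
    · by_contra! hcon
      exact hPne ((hm x k hcon.1.symm).trans ((hQ k hkk).trans (hm x' k hcon.2.symm).symm))
    · by_contra! hcon
      exact hQne ((hm x k' hcon.1.symm).symm.trans
        ((hP k' (Ne.symm hkk)).trans (hm x' k' hcon.2.symm)))
  have h1 := hpair _ hs y hy (Ne.symm hys)
  have h2 := hpair _ hs w hw (Ne.symm hws)
  have h3 := hpair y hy w hw (Ne.symm hwy)
  grind

theorem exists_coordinate_eq (hL : ∀ α, IsSCS (L α)) (hN : ∀ α, IsOrtho (L α) (N α))
    (hM : IsWTP L M) (hN' : IsOrtho M N') (hφ : ∀ q, N' {φ q} = pointSharp N q)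
    {β k : Ω} {p : ∀ α, σ α} (h : MapsLine L φ β k p) :
    ∃ c, φ c β = p β ∧ φ c ∉ pointSharp N p := by
  have hp' := hM.1.2.2.2 p
  have hA := section_mem hL hM (hN'.1 _ hp') (φ p) k
  set A := {y | Function.update (φ p) k y ∈ N' {p}} with hAdef
  have hpA : φ p k ∉ A := by
    rw [hAdef, mem_ofPred_eq, Function.update_eq_self,
      ortho_map_adjoint hM hN' hφ]
    exact notMem_pointSharp_self hL hN p
  obtain ⟨y, hy, hyp⟩ : ∃ y ∈ N k A, y ∉ N k {φ p k} := by
    rw [← (hN k).mem_iff (hL k) hA] at hpA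
    exact not_subset.1 hpA
  have hline : ∀ x ∈ centralCover (L β) (p β),
      φ (Function.update p β x) k ∈ N k {y} ↔
        φ (Function.update (φ p) k y) ∈ pointSharp N (Function.update p β x) := by
    intro x hx
    rw [← hφ, hN'.mem_comm hM.1, hφ]
    constructor
    · exact fun hxy => ⟨k, by simpa using hxy⟩
    · intro hmem
      obtain ⟨j, hj⟩ := mem_pointSharp.1 hmem
      by_cases hjk : j = k
      · subst hjk
        simpa using hj
      · rw [Function.update_of_ne hjk, h x hx j hjk] at hj
        exact absurd hj ((hN j).notMem_self (hL j) _)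
  set c := Function.update (φ p) k y with hc
  have hcp : φ c ∉ pointSharp N p := by
    have := hline (p β) (mem_centralCover_self _)
    rw [Function.update_eq_self] at this
    rw [← this, (hN k).mem_comm (hL k)]
    exact hyp
  refine ⟨c, ?_, hcp⟩
  have hcβ : φ c β ∈ centralCover (L β) (p β) := by
    by_contra hcon
    exact hcp ⟨β, (hN β).mem_symm (hL β) ((hN β).mem_of_notMem_centralCover (hL β) hcon)⟩
  have hsub : N β {p β} ⊆ N β {φ c β} := by
    intro x hx
    by_cases hxe : x ∈ centralCover (L β) (p β)
    · have hxA : φ (Function.update p β x) k ∈ A := by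
        have heq : Function.update (φ p) k (φ (Function.update p β x) k) =
            φ (Function.update p β x) := by
          funext j
          by_cases hjk : j = k
          · subst hjk
            simp
          · rw [Function.update_of_ne hjk, h x hxe j hjk]
        rw [hAdef, mem_ofPred_eq, heq, ortho_map_adjoint hM hN' hφ]
        exact ⟨β, by simpa using (hN β).mem_symm (hL β) hx⟩
      obtain ⟨j, hj⟩ := mem_pointSharp.1
        ((hline x hxe).1 ((hN k).subset_singleton (hL k) hA hy hxA))
      by_cases hjβ : j = β
      · subst hjβ
        exact (hN j).mem_symm (hL j) (by simpa using hj)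
      · rw [Function.update_of_ne hjβ] at hj
        exact absurd ⟨j, hj⟩ hcp
    · refine (hN β).mem_of_notMem_centralCover (hL β) fun hcon => hxe ?_
      have hequiv := equivalence_centralCover (L β)
      exact hequiv.trans hcβ (hequiv.symm hcon)
  exact ((hN β).mem_iff (hL β) ((hL β).2.2.2 _)).1 hsub

theorem ortho_map_surjective [Finite Ω] (hL : ∀ α, IsSCS (L α))
    (hN : ∀ α, IsOrtho (L α) (N α))
    (hM : IsWTP L M) (hN' : IsOrtho M N') (hφ : ∀ q, N' {φ q} = pointSharp N q)
    (hcomp : ∀ α, ∀ p : σ α,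
      (∃ q ∈ centralCover (L α) p, ∃ r ∈ centralCover (L α) p, q ≠ r) →
      WeaklyConnected (restrictSCS (L α) (centralCover (L α) p))) :
    Function.Surjective φ := by
  intro p
  have hex := exists_mapsLine hL hN hM hN' hφ hcomp
  have hequiv := fun α => equivalence_centralCover (L α)
  have hcover : ∀ q r : ∀ α, σ α, q ∉ pointSharp N r → ∀ α, q α ∈ centralCover (L α) (r α) := by
    intro q r hqr α
    by_contra hcon
    exact hqr ⟨α, (hN α).mem_symm (hL α) ((hN α).mem_of_notMem_centralCover (hL α) hcon)⟩
  choose f hf using fun β => hex β p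
  choose C hC hCp using fun β => exists_coordinate_eq hL hN hM hN' hφ (hf β)
  have hCE : ∀ β α, C β α ∈ centralCover (L α) (p α) := fun β α =>
    (hequiv α).trans (hcover _ _ (hCp β) α)
      ((hequiv α).symm (hcover _ _ (ortho_map_notMem hM hN' hφ (C β)) α))
  have hdir : ∀ q, (∀ α, q α ∈ centralCover (L α) (p α)) → ∀ β, MapsLine L φ β (f β) q := by
    intro q hq β
    refine coordinate_induction (P := fun w => MapsLine L φ β (f β) w) (hf β)
      fun w i hw hwm => hwm.update hL hN hφ hcomp hex i ?_
    rcases hw i with h' | h' <;> rw [h']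
    · exact hq i
    · exact mem_centralCover_self _
  refine ⟨fun i => C (f i) i, funext fun k => ?_⟩
  refine coordinate_induction (P := fun w => φ w k = p k) (hC k) fun w i hw hwk => ?_
  by_cases hik : f i = k
  · have : w i = C (f i) i := by
      rcases hw i with h' | h'
      · rw [h', hik]
      · exact h'
    change φ (Function.update w i (C (f i) i)) k = p k
    rwa [← this, Function.update_eq_self]
  · have hwE : ∀ α, w α ∈ centralCover (L α) (p α) := fun α => by
      rcases hw α with h' | h' <;> rw [h'] <;> exact hCE _ α
    refine Eq.trans ?_ hwk
    exact hdir w hwE i _ ((hequiv i).trans ((hequiv i).symm (hwE i)) (hCE _ i)) k (Ne.symm hik)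

end WeakTensorProduct

/-- if `L₁, …, L_n` are orthocomplemented and every irreducible component
different from `2` of each `L_i` (i.e. every interval `[0, e(p)]` over a central cover
containing at least two points) is weakly connected, then a weak tensor product
`M ∈ S(L₁,…,L_n)` admitting an orthocomplementation equals `∧○_{i=1}^n L_i`. -/
theorem stmt17 {n : ℕ} {σ : Fin n → Type*} [∀ i, Nonempty (σ i)]
    (L : ∀ i, Set (Set (σ i))) (hL : ∀ i, IsSCS (L i))
    (N : ∀ i, Set (σ i) → Set (σ i)) (hN : ∀ i, IsOrtho (L i) (N i))
    (hcomp : ∀ i, ∀ p : σ i,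
      (∃ q ∈ centralCover (L i) p, ∃ r ∈ centralCover (L i) p, q ≠ r) →
      WeaklyConnected (restrictSCS (L i) (centralCover (L i) p)))
    (M : Set (Set (∀ i, σ i))) (hM : IsWTP L M)
    (horth : ∃ N' : Set (∀ i, σ i) → Set (∀ i, σ i), IsOrtho M N') :
    M = wedgeO L := by
  obtain ⟨N', hN'⟩ := horth
  choose φ hφ using exists_ortho_eq_pointSharp hL hN hM hN'
  refine Subset.antisymm (fun a ha => ?_) ?_
  · refine ⟨{y | ∃ q, φ q ∈ N' a ∧ y = pointSharp N q}, ?_, ?_⟩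
    · rintro _ ⟨q, -, rfl⟩
      exact ⟨_, fun i => (hN i).1 _ ((hL i).2.2.2 _), rfl⟩
    · ext x
      rw [← hN'.mem_iff hM.1 ha]
      constructor
      · rintro hx _ ⟨q, hq, rfl⟩
        rw [← hφ]
        exact hN'.mem_symm hM.1 (hx hq)
      · intro hx t ht
        obtain ⟨q, rfl⟩ := ortho_map_surjective hL hN hM hN' hφ hcomp t
        rw [hN'.mem_comm hM.1, hφ]
        exact hx _ ⟨q, ht, rfl⟩
  · rintro _ ⟨ω, hω, rfl⟩
    refine hM.1.1 _ fun y hy => ?_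
    obtain ⟨a, ha, rfl⟩ := hω y hy
    exact hM.2.1 a ha

end QLTensor
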